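/- arXiv:1111.6565 — 4 statements merged into one kernel-verified Lean document; each statement's English description precedes it below -/
import Mathlib

section
/- Let H be a real inner product space and, for real q, t, define F_n(g_1,…,g_n; h_1,…,h_n) := ∑_{π ∈ S_n} q^{inv(π)} t^{coinv(π)} ∏_{i=1}^{n} ⟨g_i, h_{π(i)}⟩, with F_0 := 1. Then for all n ≥ 1 and all vectors g_1,…,g_n, h_1,…,h_n ∈ H, F_n(g_1,…,g_n; h_1,…,h_n) = ∑_{k=1}^{n} q^{k-1} t^{n-k} ⟨g_1, h_k⟩ · F_{n-1}(g_2,…,g_n; h_1,…,h_{k-1},h_{k+1},…,h_n). -/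
open Finset
open scoped RealInnerProductSpace

/-- Number of inversions of a permutation: pairs `i < j` with `σ i > σ j`. -/
def invCount {n : ℕ} (σ : Equiv.Perm (Fin n)) : ℕ :=
  ((univ : Finset (Fin n × Fin n)).filter fun p => p.1 < p.2 ∧ σ p.2 < σ p.1).card

/-- Number of coinversions of a permutation: pairs `i < j` with `σ i < σ j`. -/
def coinvCount {n : ℕ} (σ : Equiv.Perm (Fin n)) : ℕ :=
  ((univ : Finset (Fin n × Fin n)).filter fun p => p.1 < p.2 ∧ σ p.1 < σ p.2).card

/-- `F_n(g_1,…,g_n;h_1,…,h_n) = ∑_{π ∈ S_n} q^{inv π} t^{coinv π} ∏_i ⟨g_i, h_{π i}⟩`. -/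
noncomputable def Fqt {H : Type*} [NormedAddCommGroup H] [InnerProductSpace ℝ H]
    (q t : ℝ) {n : ℕ} (g h : Fin n → H) : ℝ :=
  ∑ π : Equiv.Perm (Fin n),
    q ^ invCount π * t ^ coinvCount π * ∏ i, ⟪g i, h (π i)⟫

/-- The permutation of `Fin (m + 1)` sending `0` to `k` and `j.succ` to `k.succAbove (τ j)`. -/
def insertZeroPerm {m : ℕ} (k : Fin (m + 1)) (τ : Equiv.Perm (Fin m)) :
    Equiv.Perm (Fin (m + 1)) :=
  (Equiv.Perm.decomposeFin.symm (0, τ)).trans k.cycleRange.symm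

@[simp]
theorem insertZeroPerm_zero {m : ℕ} (k : Fin (m + 1)) (τ : Equiv.Perm (Fin m)) :
    insertZeroPerm k τ 0 = k := by
  simp [insertZeroPerm]

@[simp]
theorem insertZeroPerm_succ {m : ℕ} (k : Fin (m + 1)) (τ : Equiv.Perm (Fin m)) (j : Fin m) :
    insertZeroPerm k τ j.succ = k.succAbove (τ j) := by
  simp [insertZeroPerm]

theorem insertZeroPerm_bijective (m : ℕ) :
    Function.Bijective fun p : Fin (m + 1) × Equiv.Perm (Fin m) => insertZeroPerm p.1 p.2 := by
  rw [Fintype.bijective_iff_injective_and_card]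
  refine ⟨?_, (Fintype.card_congr Equiv.Perm.decomposeFin).symm⟩
  rintro ⟨k, τ⟩ ⟨l, ρ⟩ h
  replace h : insertZeroPerm k τ = insertZeroPerm l ρ := h
  obtain rfl : k = l := by simpa using DFunLike.congr_fun h 0
  obtain rfl : τ = ρ := by
    ext1 j
    simpa using DFunLike.congr_fun h j.succ
  rfl

theorem sum_ite_succAbove_lt {m : ℕ} (k : Fin (m + 1)) :
    ∑ j : Fin m, (if k.succAbove j < k then 1 else 0) = (k : ℕ) := by
  have h := Fin.sum_univ_succAbove (fun i : Fin (m + 1) => if i < k then 1 else 0) k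
  simp only [lt_irrefl, if_false, zero_add] at h
  rw [← h, ← card_filter, filter_gt_eq_Iio, Fin.card_Iio]

theorem sum_ite_lt_succAbove {m : ℕ} (k : Fin (m + 1)) :
    ∑ j : Fin m, (if k < k.succAbove j then 1 else 0) = m - (k : ℕ) := by
  have h := Fin.sum_univ_succAbove (fun i : Fin (m + 1) => if k < i then 1 else 0) k
  simp only [lt_irrefl, if_false, zero_add] at h
  rw [← h, ← card_filter, filter_lt_eq_Ioi, Fin.card_Ioi]
  omega

theorem invCount_insertZeroPerm {m : ℕ} (k : Fin (m + 1)) (τ : Equiv.Perm (Fin m)) :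
    invCount (insertZeroPerm k τ) = k + invCount τ := by
  simp only [invCount, card_filter, Fintype.sum_prod_type, Fin.sum_univ_succ]
  simp [Fin.succ_lt_succ_iff, Fin.succAbove_lt_succAbove_iff, -sum_boole]
  rw [Equiv.sum_comp τ fun j => if k.succAbove j < k then 1 else 0, sum_ite_succAbove_lt]

theorem coinvCount_insertZeroPerm {m : ℕ} (k : Fin (m + 1)) (τ : Equiv.Perm (Fin m)) :
    coinvCount (insertZeroPerm k τ) = (m - k) + coinvCount τ := by
  simp only [coinvCount, card_filter, Fintype.sum_prod_type, Fin.sum_univ_succ]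
  simp [Fin.succ_lt_succ_iff, Fin.succAbove_lt_succAbove_iff, -sum_boole]
  rw [Equiv.sum_comp τ fun j => if k < k.succAbove j then 1 else 0, sum_ite_lt_succAbove]

/-- The recursion for `F_n` (stated with `n = m + 1`; the paper's one-indexed
`q^{k-1} t^{n-k}` becomes `q^k t^{m-k}` for `k : Fin (m+1)`); removing the `k`-th
entry of `h` is realized by precomposition with `Fin.succAbove k`. -/
theorem stmt4 {H : Type*} [NormedAddCommGroup H] [InnerProductSpace ℝ H]
    (q t : ℝ) (m : ℕ) (g h : Fin (m + 1) → H) :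
    Fqt q t g h
      = ∑ k : Fin (m + 1),
          q ^ (k : ℕ) * t ^ (m - (k : ℕ)) * ⟪g 0, h k⟫ *
            Fqt q t (fun j => g j.succ) (fun j => h (k.succAbove j)) := by
  unfold Fqt
  rw [← (insertZeroPerm_bijective m).sum_comp, Fintype.sum_prod_type]
  refine sum_congr rfl fun k _ => ?_
  rw [mul_sum]
  refine sum_congr rfl fun τ _ => ?_
  simp only [invCount_insertZeroPerm, coinvCount_insertZeroPerm, Fin.prod_univ_succ,
    insertZeroPerm_zero, insertZeroPerm_succ, pow_add]
  ring
end

section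
/- Let q, t be real numbers with t > 0 and |q| ≤ t. For every n ≥ 1, the real matrix A indexed by S_n × S_n with entries A_{σ,τ} = q^{inv(τσ⁻¹)} t^{coinv(τσ⁻¹)} is positive semidefinite. -/
open Finset

/-- `1` or `-1` according to whether `σ` preserves or reverses the order of the entries of `p`. -/
def pairSign {n : ℕ} (σ : Equiv.Perm (Fin n)) (p : Fin n × Fin n) : ℝ :=
  if σ p.1 < σ p.2 then 1 else -1

/-- The image of the pair `p` under `σ`, rearranged in increasing order. -/
def sortedImage {n : ℕ} (σ : Equiv.Perm (Fin n)) (p : Fin n × Fin n) : Fin n × Fin n :=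
  if σ p.1 < σ p.2 then (σ p.1, σ p.2) else (σ p.2, σ p.1)

lemma sortedImage_lt {n : ℕ} (σ : Equiv.Perm (Fin n)) {p : Fin n × Fin n} (hp : p.1 < p.2) :
    (sortedImage σ p).1 < (sortedImage σ p).2 := by
  unfold sortedImage
  have h : σ p.1 ≠ σ p.2 := fun h => hp.ne (σ.injective h)
  split_ifs with h1
  · exact h1
  · exact lt_of_le_of_ne (not_lt.mp h1) h.symm

lemma sortedImage_inv {n : ℕ} (σ : Equiv.Perm (Fin n)) {p : Fin n × Fin n} (hp : p.1 < p.2) :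
    sortedImage σ⁻¹ (sortedImage σ p) = p := by
  unfold sortedImage
  split_ifs with h1 h2 h2 <;> simp_all [not_lt_of_gt]

lemma weight_eq_prod {n : ℕ} (q t : ℝ) (ρ : Equiv.Perm (Fin n)) :
    q ^ invCount ρ * t ^ coinvCount ρ =
      ∏ p ∈ (univ : Finset (Fin n × Fin n)).filter (fun p => p.1 < p.2),
        if ρ p.2 < ρ p.1 then q else t := by
  rw [prod_ite, prod_const, prod_const, filter_filter, filter_filter, invCount, coinvCount]
  congr 3
  ext p
  simp only [mem_filter, mem_univ, true_and, not_lt]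
  refine and_congr_right fun hp => ⟨le_of_lt, fun h => lt_of_le_of_ne h fun h' => ?_⟩
  exact hp.ne (ρ.injective h')

lemma weight_mul_inv_eq_prod {n : ℕ} (q t : ℝ) (σ τ : Equiv.Perm (Fin n)) :
    q ^ invCount (τ * σ⁻¹) * t ^ coinvCount (τ * σ⁻¹) =
      ∏ p ∈ (univ : Finset (Fin n × Fin n)).filter (fun p => p.1 < p.2),
        ((t - q) / 2 * (pairSign σ p * pairSign τ p) + (t + q) / 2) := by
  rw [weight_eq_prod]
  symm
  refine prod_bij' (fun p _ => sortedImage σ p) (fun p _ => sortedImage σ⁻¹ p) ?_ ?_ ?_ ?_ ?_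
  · intro p hp
    simpa using sortedImage_lt σ (by simpa using hp)
  · intro p hp
    simpa using sortedImage_lt σ⁻¹ (by simpa using hp)
  · intro p hp
    exact sortedImage_inv σ (by simpa using hp)
  · intro p hp
    simpa using sortedImage_inv σ⁻¹ (p := p) (by simpa using hp)
  · intro p hp
    have hp : p.1 < p.2 := by simpa using hp
    have h : τ p.1 ≠ τ p.2 := fun h => hp.ne (τ.injective h)
    unfold sortedImage pairSign
    rcases lt_or_gt_of_ne h with h | h <;> by_cases h1 : σ p.1 < σ p.2 <;>
      simp [h, h1, not_lt_of_gt h] <;> ring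

/-- For `t > 0` and `|q| ≤ t`, the matrix `A_{σ,τ} = q^{inv(τσ⁻¹)} t^{coinv(τσ⁻¹)}`
indexed by `S_n × S_n` is positive semidefinite. -/
theorem stmt5 (q t : ℝ) (ht : 0 < t) (hqt : |q| ≤ t) (n : ℕ) (hn : 1 ≤ n)
    (x : Equiv.Perm (Fin n) → ℝ) :
    0 ≤ ∑ σ : Equiv.Perm (Fin n), ∑ τ : Equiv.Perm (Fin n),
        x σ * (q ^ invCount (τ * σ⁻¹) * t ^ coinvCount (τ * σ⁻¹)) * x τ := by
  have hα : 0 ≤ (t - q) / 2 := by linarith [le_abs_self q]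
  have hβ : 0 ≤ (t + q) / 2 := by linarith [neg_abs_le q]
  set P := (univ : Finset (Fin n × Fin n)).filter (fun p => p.1 < p.2) with hP
  have key : ∑ σ : Equiv.Perm (Fin n), ∑ τ : Equiv.Perm (Fin n),
        x σ * (q ^ invCount (τ * σ⁻¹) * t ^ coinvCount (τ * σ⁻¹)) * x τ =
      ∑ T ∈ P.powerset, ((t - q) / 2) ^ T.card * ((t + q) / 2) ^ (P \ T).card *
        (∑ σ : Equiv.Perm (Fin n), x σ * ∏ p ∈ T, pairSign σ p) ^ 2 := by
    simp_rw [weight_mul_inv_eq_prod, ← hP, prod_add, prod_mul_distrib, prod_const, sq,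
      sum_mul_sum, mul_sum, sum_mul]
    rw [sum_comm (s := P.powerset)]
    refine sum_congr rfl fun σ _ => ?_
    rw [sum_comm (s := P.powerset)]
    refine sum_congr rfl fun τ _ => sum_congr rfl fun T _ => ?_
    ring
  rw [key]
  exact sum_nonneg fun T _ => by positivity
end

section
/- Let q, t be real numbers with t > 0 and |q| < t. For every n ≥ 1, the real matrix A indexed by S_n × S_n with entries A_{σ,τ} = q^{inv(τσ⁻¹)} t^{coinv(τσ⁻¹)} is positive definite, i.e. ∑_{σ,τ} x_σ A_{σ,τ} x_τ > 0 for every nonzero real vector (x_σ)_{σ ∈ S_n}. -/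
open Finset

/-- A kernel `∏ i, (a + b χᵢ(u) χᵢ(v))` built from signs `χᵢ` that separate points is positive
definite when `a, b > 0`. -/
theorem sum_sum_mul_prod_add_sign_pos {X ι : Type*} [Fintype X] [DecidableEq ι]
    (P : Finset ι) (χ : X → ι → ℝ) (hχ : ∀ u i, χ u i = 1 ∨ χ u i = -1)
    (hsep : ∀ u v, u ≠ v → ∃ i ∈ P, χ u i ≠ χ v i)
    {a b : ℝ} (ha : 0 < a) (hb : 0 < b) (x : X → ℝ) (hx : x ≠ 0) :
    0 < ∑ u, ∑ v, x u * (∏ i ∈ P, (b * (χ u i * χ v i) + a)) * x v := by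
  have expand : ∑ u, ∑ v, x u * (∏ i ∈ P, (b * (χ u i * χ v i) + a)) * x v =
      ∑ S ∈ P.powerset, b ^ #S * a ^ #(P \ S) * (∑ u, x u * ∏ i ∈ S, χ u i) ^ 2 := by
    simp_rw [Finset.prod_add, Finset.prod_mul_distrib, Finset.prod_const, Finset.mul_sum,
      Finset.sum_mul, sq, Finset.sum_mul_sum, Finset.mul_sum]
    rw [Finset.sum_comm (s := P.powerset)]
    refine Finset.sum_congr rfl fun u _ => ?_
    rw [Finset.sum_comm (s := P.powerset)]
    refine Finset.sum_congr rfl fun v _ => Finset.sum_congr rfl fun S _ => ?_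
    ring
  rw [expand]
  have nonneg : ∀ S ∈ P.powerset,
      0 ≤ b ^ #S * a ^ #(P \ S) * (∑ u, x u * ∏ i ∈ S, χ u i) ^ 2 := fun S _ => by positivity
  refine (Finset.sum_nonneg nonneg).lt_of_ne' fun h0 => hx ?_
  rw [Finset.sum_eq_zero_iff_of_nonneg nonneg] at h0
  have walsh : ∀ S ∈ P.powerset, ∑ u, x u * ∏ i ∈ S, χ u i = 0 := fun S hS => by
    have := h0 S hS
    have hpos : b ^ #S * a ^ #(P \ S) ≠ 0 := by positivity
    simpa [hpos, ha.ne', hb.ne'] using this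
  funext v
  have hv : ∑ u, x u * ∏ i ∈ P, (χ u i * χ v i + 1) = 0 := by
    simp_rw [Finset.prod_add, Finset.prod_mul_distrib, Finset.prod_const_one, mul_one,
      Finset.mul_sum]
    rw [Finset.sum_comm]
    refine Finset.sum_eq_zero fun S hS => ?_
    simp_rw [← mul_assoc, ← Finset.sum_mul, walsh S hS, zero_mul]
  rw [Finset.sum_eq_single v] at hv
  · refine (mul_eq_zero.mp hv).resolve_right (Finset.prod_ne_zero_iff.mpr fun i _ => ?_)
    rcases hχ v i with h | h <;> rw [h] <;> norm_num
  · intro u _ huv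
    obtain ⟨i, hi, hne⟩ := hsep u v huv
    rw [Finset.prod_eq_zero hi, mul_zero]
    rcases hχ u i with h | h <;> rcases hχ v i with h' | h' <;> simp_all
  · simp

/-- The sign recording in which order `σ` puts the two entries of the pair `p`. -/
def orderSign {n : ℕ} (σ : Equiv.Perm (Fin n)) (p : Fin n × Fin n) : ℝ :=
  if σ p.1 < σ p.2 then 1 else -1

theorem orderSign_eq_one_or {n : ℕ} (σ : Equiv.Perm (Fin n)) (p : Fin n × Fin n) :
    orderSign σ p = 1 ∨ orderSign σ p = -1 := by
  unfold orderSign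
  split_ifs <;> simp

theorem orderSign_eq_iff {n : ℕ} (σ τ : Equiv.Perm (Fin n)) (p : Fin n × Fin n) :
    orderSign σ p = orderSign τ p ↔ (σ p.1 < σ p.2 ↔ τ p.1 < τ p.2) := by
  unfold orderSign
  split_ifs <;> norm_num [*]

theorem exists_orderSign_ne {n : ℕ} {σ τ : Equiv.Perm (Fin n)} (h : σ ≠ τ) :
    ∃ p ∈ (univ : Finset (Fin n × Fin n)).filter (fun p => p.1 < p.2),
      orderSign σ p ≠ orderSign τ p := by
  by_contra! hall
  have key : ∀ i j, i < j → (σ i < σ j ↔ τ i < τ j) := fun i j hij =>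
    (orderSign_eq_iff σ τ (i, j)).mp (hall (i, j) (by simpa using hij))
  have mono : StrictMono (τ ∘ σ.symm) := by
    intro i j hij
    rcases lt_trichotomy (σ.symm i) (σ.symm j) with hlt | heq | hgt
    · exact (key _ _ hlt).mp (by simpa using hij)
    · exact absurd (σ.symm.injective heq) hij.ne
    · have hnot : ¬ τ (σ.symm j) < τ (σ.symm i) := fun hc =>
        absurd ((key _ _ hgt).mpr hc) (by simpa using hij.le)
      exact (not_lt.mp hnot).lt_of_ne fun hc => hgt.ne' (τ.injective hc)
  have hid : τ ∘ σ.symm = id := (mono.range_inj strictMono_id).mp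
    (by rw [(τ.surjective.comp σ.symm.surjective).range_eq, Set.range_id])
  refine h (Equiv.ext fun i => ?_)
  simpa using (congrFun hid (σ i)).symm

/-- Applying `σ` and sorting permutes the pairs `i < j`, so pairs of values satisfying a relation
can be counted through the corresponding pairs of positions. -/
theorem card_filter_perm_pairs {n : ℕ} (σ : Equiv.Perm (Fin n)) (r : Fin n → Fin n → Prop)
    [DecidableRel r] :
    #((univ : Finset (Fin n × Fin n)).filter fun p => p.1 < p.2 ∧ r (σ.symm p.1) (σ.symm p.2)) =
      #((univ : Finset (Fin n × Fin n)).filter fun p => p.1 < p.2 ∧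
        if σ p.1 < σ p.2 then r p.1 p.2 else r p.2 p.1) := by
  refine Finset.card_nbij'
    (fun p => if σ.symm p.1 < σ.symm p.2 then (σ.symm p.1, σ.symm p.2)
      else (σ.symm p.2, σ.symm p.1))
    (fun p => if σ p.1 < σ p.2 then (σ p.1, σ p.2) else (σ p.2, σ p.1)) ?_ ?_ ?_ ?_
  · rintro ⟨i, j⟩ h
    simp only [coe_filter, mem_univ, true_and, Set.mem_ofPred_eq] at h ⊢
    have hne : σ.symm i ≠ σ.symm j := fun hc => h.1.ne (σ.symm.injective hc)
    rcases hne.lt_or_gt with hlt | hgt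
    · simp [hlt, h]
    · simp [hgt, hgt.not_gt, h, h.1.not_gt]
  · rintro ⟨i, j⟩ h
    simp only [coe_filter, mem_univ, true_and, Set.mem_ofPred_eq] at h ⊢
    have hne : σ i ≠ σ j := fun hc => h.1.ne (σ.injective hc)
    rcases hne.lt_or_gt with hlt | hgt
    · simpa [hlt] using h.2
    · simpa [hgt, hgt.not_gt] using h.2
  · rintro ⟨i, j⟩ h
    simp only [coe_filter, mem_univ, true_and, Set.mem_ofPred_eq] at h ⊢
    split_ifs <;> simp_all <;> grind
  · rintro ⟨i, j⟩ h
    simp only [coe_filter, mem_univ, true_and, Set.mem_ofPred_eq] at h ⊢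
    split_ifs <;> simp_all <;> grind

theorem invCount_mul_inv {n : ℕ} (σ τ : Equiv.Perm (Fin n)) :
    invCount (τ * σ⁻¹) = #(((univ : Finset (Fin n × Fin n)).filter fun p => p.1 < p.2).filter
      fun p => ¬ orderSign σ p = orderSign τ p) := by
  rw [Finset.filter_filter]
  refine (card_filter_perm_pairs σ fun i j => τ j < τ i).trans (congrArg card ?_)
  refine Finset.filter_congr fun p _ => and_congr_right fun hp => ?_
  have hne : τ p.1 ≠ τ p.2 := fun hc => hp.ne (τ.injective hc)
  rw [orderSign_eq_iff]
  grind

theorem coinvCount_mul_inv {n : ℕ} (σ τ : Equiv.Perm (Fin n)) :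
    coinvCount (τ * σ⁻¹) = #(((univ : Finset (Fin n × Fin n)).filter fun p => p.1 < p.2).filter
      fun p => orderSign σ p = orderSign τ p) := by
  rw [Finset.filter_filter]
  refine (card_filter_perm_pairs σ fun i j => τ i < τ j).trans (congrArg card ?_)
  refine Finset.filter_congr fun p _ => and_congr_right fun hp => ?_
  have hne : τ p.1 ≠ τ p.2 := fun hc => hp.ne (τ.injective hc)
  rw [orderSign_eq_iff]
  grind

theorem pow_invCount_mul_pow_coinvCount {n : ℕ} (q t : ℝ) (σ τ : Equiv.Perm (Fin n)) :
    q ^ invCount (τ * σ⁻¹) * t ^ coinvCount (τ * σ⁻¹) =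
      ∏ p ∈ (univ : Finset (Fin n × Fin n)).filter (fun p => p.1 < p.2),
        ((t - q) / 2 * (orderSign σ p * orderSign τ p) + (t + q) / 2) := by
  have hfactor : ∀ p : Fin n × Fin n,
      (t - q) / 2 * (orderSign σ p * orderSign τ p) + (t + q) / 2 =
        if orderSign σ p = orderSign τ p then t else q := fun p => by
    rcases orderSign_eq_one_or σ p with h | h <;> rcases orderSign_eq_one_or τ p with h' | h' <;>
      rw [h, h'] <;> norm_num <;> ring
  simp_rw [hfactor]
  rw [Finset.prod_ite, Finset.prod_const, Finset.prod_const, invCount_mul_inv, coinvCount_mul_inv,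
    mul_comm]

/-- For `t > 0` and `|q| < t`, the matrix `A_{σ,τ} = q^{inv(τσ⁻¹)} t^{coinv(τσ⁻¹)}`
indexed by `S_n × S_n` is positive definite. -/
theorem stmt6 (q t : ℝ) (ht : 0 < t) (hqt : |q| < t) (n : ℕ) (hn : 1 ≤ n)
    (x : Equiv.Perm (Fin n) → ℝ) (hx : x ≠ 0) :
    0 < ∑ σ : Equiv.Perm (Fin n), ∑ τ : Equiv.Perm (Fin n),
        x σ * (q ^ invCount (τ * σ⁻¹) * t ^ coinvCount (τ * σ⁻¹)) * x τ := by
  obtain ⟨hq₁, hq₂⟩ := abs_lt.mp hqt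
  simp_rw [pow_invCount_mul_pow_coinvCount]
  exact sum_sum_mul_prod_add_sign_pos _ orderSign orderSign_eq_one_or
    (fun _ _ => exists_orderSign_ne) (by linarith) (by linarith) x hx
end

section
/- Let q, t be real numbers with 0 < q < t < 1 and set n_* = ⌈(log(1−q) − log(1−t)) / (log t − log q)⌉. Then n_* ≥ 1 and for every integer n ≥ 1 one has t^n − q^n ≤ t^{n_*} − q^{n_*}; that is, the sequence n ↦ t^n − q^n attains its maximum over the positive integers at n = n_*. -/
theorem log_pow_mul_one_sub {x : ℝ} (hx0 : 0 < x) (hx1 : x < 1) (n : ℕ) :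
    Real.log (x ^ n * (1 - x)) = n * Real.log x + Real.log (1 - x) := by
  rw [Real.log_mul (pow_pos hx0 n).ne' (sub_pos.2 hx1).ne', Real.log_pow]

theorem pow_mul_one_sub_pos {x : ℝ} (hx0 : 0 < x) (hx1 : x < 1) (n : ℕ) :
    0 < x ^ n * (1 - x) :=
  mul_pos (pow_pos hx0 n) (sub_pos.2 hx1)

/-- The sequence `n ↦ t ^ n - q ^ n` does not decrease at step `n` exactly when `n` is at most
`(log (1 - q) - log (1 - t)) / (log t - log q)`. -/
theorem pow_sub_pow_le_succ_iff {q t : ℝ} (hq : 0 < q) (hqt : q < t) (ht : t < 1) (n : ℕ) :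
    t ^ n - q ^ n ≤ t ^ (n + 1) - q ^ (n + 1) ↔
      (n : ℝ) ≤ (Real.log (1 - q) - Real.log (1 - t)) / (Real.log t - Real.log q) := by
  have ht0 : 0 < t := hq.trans hqt
  have hq1 : q < 1 := hqt.trans ht
  calc t ^ n - q ^ n ≤ t ^ (n + 1) - q ^ (n + 1)
      ↔ t ^ n * (1 - t) ≤ q ^ n * (1 - q) := by
        rw [pow_succ, pow_succ]
        constructor <;> intro h <;> linarith
    _ ↔ Real.log (t ^ n * (1 - t)) ≤ Real.log (q ^ n * (1 - q)) :=
        (Real.log_le_log_iff (pow_mul_one_sub_pos ht0 ht n) (pow_mul_one_sub_pos hq hq1 n)).symm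
    _ ↔ _ := by
        rw [log_pow_mul_one_sub ht0 ht, log_pow_mul_one_sub hq hq1,
          le_div_iff₀ (sub_pos.2 (Real.log_lt_log hq hqt))]
        constructor <;> intro h <;> linarith

/-- The sequence `n ↦ t ^ n - q ^ n` does not increase at step `n` exactly when `n` is at least
`(log (1 - q) - log (1 - t)) / (log t - log q)`. -/
theorem pow_sub_pow_succ_le_iff {q t : ℝ} (hq : 0 < q) (hqt : q < t) (ht : t < 1) (n : ℕ) :
    t ^ (n + 1) - q ^ (n + 1) ≤ t ^ n - q ^ n ↔
      (Real.log (1 - q) - Real.log (1 - t)) / (Real.log t - Real.log q) ≤ n := by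
  have ht0 : 0 < t := hq.trans hqt
  have hq1 : q < 1 := hqt.trans ht
  calc t ^ (n + 1) - q ^ (n + 1) ≤ t ^ n - q ^ n
      ↔ q ^ n * (1 - q) ≤ t ^ n * (1 - t) := by
        rw [pow_succ, pow_succ]
        constructor <;> intro h <;> linarith
    _ ↔ Real.log (q ^ n * (1 - q)) ≤ Real.log (t ^ n * (1 - t)) :=
        (Real.log_le_log_iff (pow_mul_one_sub_pos hq hq1 n) (pow_mul_one_sub_pos ht0 ht n)).symm
    _ ↔ _ := by
        rw [log_pow_mul_one_sub ht0 ht, log_pow_mul_one_sub hq hq1,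
          div_le_iff₀ (sub_pos.2 (Real.log_lt_log hq hqt))]
        constructor <;> intro h <;> linarith

/-- A sequence that does not decrease before `N` and does not increase from `N` on is maximal
at `N`. -/
theorem le_of_le_succ_of_succ_le {α : Type*} [Preorder α] {f : ℕ → α} {N : ℕ}
    (hup : ∀ n < N, f n ≤ f (n + 1)) (hdown : ∀ n, N ≤ n → f (n + 1) ≤ f n) (n : ℕ) :
    f n ≤ f N := by
  rcases le_total n N with h | h
  · induction h using Nat.decreasingInduction with
    | self => exact le_rfl
    | of_succ k hk ih => exact (hup k hk).trans ih
  · induction n, h using Nat.le_induction with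
    | base => exact le_rfl
    | succ k hk ih => exact (hdown k hk).trans ih

/-- For `0 < q < t < 1` and `n_* = ⌈(log(1-q) - log(1-t)) / (log t - log q)⌉`,
one has `n_* ≥ 1`, and `t^n - q^n ≤ t^{n_*} - q^{n_*}` for every integer `n ≥ 1`. -/
theorem stmt7 (q t : ℝ) (hq : 0 < q) (hqt : q < t) (ht : t < 1) :
    1 ≤ ⌈(Real.log (1 - q) - Real.log (1 - t)) / (Real.log t - Real.log q)⌉ ∧
    ∀ n : ℕ, 1 ≤ n →
      t ^ n - q ^ n ≤
        t ^ (⌈(Real.log (1 - q) - Real.log (1 - t)) / (Real.log t - Real.log q)⌉.toNat)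
          - q ^ (⌈(Real.log (1 - q) - Real.log (1 - t)) / (Real.log t - Real.log q)⌉.toNat) := by
  have hlog : 0 < Real.log t - Real.log q := sub_pos.2 (Real.log_lt_log hq hqt)
  have hlog' : 0 < Real.log (1 - q) - Real.log (1 - t) :=
    sub_pos.2 (Real.log_lt_log (sub_pos.2 ht) (by linarith))
  refine ⟨Int.one_le_ceil_iff.2 (div_pos hlog' hlog), fun n _ => ?_⟩
  rw [Int.ceil_toNat]
  refine le_of_le_succ_of_succ_le (f := fun n => t ^ n - q ^ n) (fun k hk => ?_)
    (fun k hk => ?_) n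
  · exact (pow_sub_pow_le_succ_iff hq hqt ht k).2 (Nat.lt_ceil.1 hk).le
  · exact (pow_sub_pow_succ_le_iff hq hqt ht k).2 (Nat.ceil_le.1 hk)
end
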